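/- Let t > 4 be a power of 2 and let f = AD_{t,t} = AD_t ∘ₜ AND_{log t} : {-1,1}^{log t} × {-1,1}^{t·log t} → {-1,1}. Then: (i) δ(f) = 1/t; (ii) every non-empty set S in supp(f) satisfies |f̂(S)| = 2/t²; (iii) there is a universal constant C > 0 such that for every real x > 0 for which d_x := dim_{F₂}(span{S : |f̂(S)| ≥ 1/x}) > 1, one has √(d_x)/(x·√(log(x²/d_x))) ≤ C·t^{−3/2}; and (iv) there is a universal constant c > 0 such that r(f)²/(k(f)·(log k(f))²) ≥ c/t, k(f)/k'(f)² ≥ c/t, and r(f)/(k''(f)·log k(f)) ≥ c/t. -/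

import Mathlib

open scoped BigOperators
open scoped Classical

noncomputable section

namespace BoolFunc

/-- Real value of a hypercube coordinate: `true ↦ -1`, `false ↦ 1`. -/
def signv (b : Bool) : ℝ := if b then -1 else 1

/-- Fourier coefficient `f̂(S)` of `f : {-1,1}ⁿ → ℝ`. -/
def fourierCoeff {n : ℕ} (f : (Fin n → Bool) → ℝ) (S : Finset (Fin n)) : ℝ :=
  (∑ x : Fin n → Bool, f x * ∏ i ∈ S, signv (x i)) / 2 ^ n

/-- Fourier support of `f`. -/
def fourierSupport {n : ℕ} (f : (Fin n → Bool) → ℝ) : Finset (Finset (Fin n)) :=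
  Finset.univ.filter (fun S => fourierCoeff f S ≠ 0)

/-- Fourier sparsity `k(f)`. -/
def sparsity {n : ℕ} (f : (Fin n → Bool) → ℝ) : ℕ := (fourierSupport f).card

/-- Indicator vector in `F₂ⁿ` of a subset of `[n]`. -/
def indicatorVec {n : ℕ} (S : Finset (Fin n)) : Fin n → ZMod 2 :=
  fun i => if i ∈ S then 1 else 0

/-- Fourier rank `r(f)`: the `F₂`-dimension of the span of the Fourier support. -/
def fourierRank {n : ℕ} (f : (Fin n → Bool) → ℝ) : ℕ :=
  Module.finrank (ZMod 2)
    ↥(Submodule.span (ZMod 2)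
      (indicatorVec '' (fourierSupport f : Set (Finset (Fin n)))))

/-- Weight `δ(f) = Pr[f(x) = -1]`. -/
def weight {n : ℕ} (f : (Fin n → Bool) → ℝ) : ℝ :=
  ((Finset.univ.filter (fun x : Fin n → Bool => f x = -1)).card : ℝ) / 2 ^ n

/-- Fourier max-supp-entropy `k'(f) = max_{S ∈ supp(f)} 1/|f̂(S)|`. -/
def maxSuppEntropy {n : ℕ} (f : (Fin n → Bool) → ℝ) : ℝ :=
  sSup ((fun S => 1 / |fourierCoeff f S|) '' (fourierSupport f : Set (Finset (Fin n))))

/-- Dimension of the span of `{S : |f̂(S)| ≥ 1/t}`. -/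
def levelDim {n : ℕ} (f : (Fin n → Bool) → ℝ) (t : ℝ) : ℕ :=
  Module.finrank (ZMod 2)
    ↥(Submodule.span (ZMod 2)
      (indicatorVec '' {S : Finset (Fin n) | 1 / t ≤ |fourierCoeff f S|}))

/-- Fourier max-rank-entropy `k''(f)`. -/
def maxRankEntropy {n : ℕ} (f : (Fin n → Bool) → ℝ) : ℝ :=
  sInf {t : ℝ | 0 < t ∧ levelDim f t = fourierRank f}

/-- `f` is Boolean-valued (takes values in `{-1,1}`). -/
def IsBooleanFunc {n : ℕ} (f : (Fin n → Bool) → ℝ) : Prop := ∀ x, f x = 1 ∨ f x = -1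

/-- `bin(x) ∈ [t]`, reading `-1` (i.e. `true`) as bit `1` and `1` (i.e. `false`) as bit `0`. -/
def binIdx (τ : ℕ) (v : Fin τ → Bool) : Fin (2 ^ τ) :=
  finFunctionFinEquiv (fun i => if v i then (1 : Fin 2) else 0)

/-- The composed Addressing function `AD_t ∘ₜ g`, where `t = 2^τ` and each of the `t` target
variables is replaced by a copy of `g` on its own fresh block of `m` variables. -/
def ADcomp (τ m : ℕ) (g : (Fin m → Bool) → ℝ) : (Fin (τ + 2 ^ τ * m) → Bool) → ℝ :=
  fun x =>
    g (fun l =>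
      x (Fin.natAdd τ (finProdFinEquiv
        (binIdx τ (fun i => x (Fin.castAdd (2 ^ τ * m) i)), l))))

/-- `AND_m : {-1,1}^m → {-1,1}`, taking the value `-1` exactly at `(-1,…,-1)`. -/
def ANDf (m : ℕ) : (Fin m → Bool) → ℝ := fun x => if ∀ i, x i = true then -1 else 1

/-- Coordinate `l` of block `p` of the target variables. -/
def blockIdx (τ m : ℕ) (p : Fin (2 ^ τ)) (l : Fin m) : Fin (τ + 2 ^ τ * m) :=
  Fin.natAdd τ (finProdFinEquiv (p, l))

/-- `S` contains a variable of block `p`. -/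
def Touches {τ m : ℕ} (S : Finset (Fin (τ + 2 ^ τ * m))) (p : Fin (2 ^ τ)) : Prop :=
  ∃ l, blockIdx τ m p l ∈ S

/-- The set with address part `A` and target part `B` inside block `p`. -/
def blockSet {τ m : ℕ} (A : Finset (Fin τ)) (p : Fin (2 ^ τ)) (B : Finset (Fin m)) :
    Finset (Fin (τ + 2 ^ τ * m)) :=
  Finset.univ.filter fun i => Fin.addCases (motive := fun _ => Prop) (fun j => j ∈ A)
    (fun k => (finProdFinEquiv.symm k).1 = p ∧ (finProdFinEquiv.symm k).2 ∈ B) i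

section Index

variable {τ m : ℕ}

theorem index_cases (i : Fin (τ + 2 ^ τ * m)) :
    (∃ j, i = Fin.castAdd _ j) ∨ ∃ p l, i = blockIdx τ m p l := by
  induction i using Fin.addCases with
  | left j => exact Or.inl ⟨j, rfl⟩
  | right k =>
    refine Or.inr ⟨(finProdFinEquiv.symm k).1, (finProdFinEquiv.symm k).2, ?_⟩
    simp only [blockIdx, Prod.mk.eta, Equiv.apply_symm_apply]

theorem prod_index (F : Fin (τ + 2 ^ τ * m) → ℝ) :
    ∏ i, F i = (∏ j, F (Fin.castAdd _ j)) * ∏ p, ∏ l, F (blockIdx τ m p l) := by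
  rw [Fin.prod_univ_add, ← Fintype.prod_prod_type' (fun p l => F (blockIdx τ m p l))]
  congr 1
  exact (Fintype.prod_equiv finProdFinEquiv _ _ fun _ => rfl).symm

@[simp] theorem castAdd_mem_blockSet (A : Finset (Fin τ)) (p : Fin (2 ^ τ)) (B : Finset (Fin m))
    (j : Fin τ) : Fin.castAdd _ j ∈ blockSet A p B ↔ j ∈ A := by
  simp [blockSet]

@[simp] theorem blockIdx_mem_blockSet (A : Finset (Fin τ)) (p q : Fin (2 ^ τ))
    (B : Finset (Fin m)) (l : Fin m) :
    blockIdx τ m q l ∈ blockSet A p B ↔ q = p ∧ l ∈ B := by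
  simp only [blockSet, blockIdx, Finset.mem_filter, Finset.mem_univ, true_and, Fin.addCases_right,
    Equiv.symm_apply_apply]

theorem existsUnique_touches_blockSet (A : Finset (Fin τ)) (p : Fin (2 ^ τ))
    {B : Finset (Fin m)} (hB : B.Nonempty) : ∃! q, Touches (blockSet A p B) q := by
  obtain ⟨l, hl⟩ := hB
  refine ⟨p, ⟨l, by simp [hl]⟩, ?_⟩
  rintro q ⟨l', hl'⟩
  exact ((blockIdx_mem_blockSet ..).1 hl').1

theorem eq_blockSet {S : Finset (Fin (τ + 2 ^ τ * m))} {p : Fin (2 ^ τ)}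
    (hp : ∀ q, Touches S q → q = p) :
    blockSet (Finset.univ.filter fun j => Fin.castAdd _ j ∈ S) p
      (Finset.univ.filter fun l => blockIdx τ m p l ∈ S) = S := by
  ext i
  obtain ⟨j, rfl⟩ | ⟨q, l, rfl⟩ := index_cases i
  · simp
  · simp only [blockIdx_mem_blockSet, Finset.mem_filter, Finset.mem_univ, true_and]
    constructor
    · rintro ⟨rfl, h⟩
      exact h
    · intro h
      obtain rfl := hp q ⟨l, h⟩
      exact ⟨rfl, h⟩

theorem blockSet_injOn :
    Set.InjOn (fun x : Finset (Fin τ) × Fin (2 ^ τ) × Finset (Fin m) => blockSet x.1 x.2.1 x.2.2)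
      {x | x.2.2.Nonempty} := by
  rintro ⟨A, p, B⟩ ⟨l, hl⟩ ⟨A', p', B'⟩ - h
  dsimp only at h hl
  have hA : A = A' := by
    ext j
    rw [← castAdd_mem_blockSet A p B, h, castAdd_mem_blockSet]
  have hp : p = p' := by
    have : blockIdx τ m p l ∈ blockSet A p B := by simp [hl]
    rw [h] at this
    exact ((blockIdx_mem_blockSet ..).1 this).1
  subst hA hp
  have hB : B = B' := by
    ext k
    have : blockIdx τ m p k ∈ blockSet A p B ↔ blockIdx τ m p k ∈ blockSet A p B' := by rw [h]
    simpa using this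
  rw [hB]

end Index

section Fourier

theorem prod_signv {n : ℕ} (S : Finset (Fin n)) (x : Fin n → Bool) :
    ∏ i ∈ S, signv (x i) = ∏ i, if i ∈ S then signv (x i) else 1 := by
  simp

theorem fourierCoeff_prod {n : ℕ} (g : Fin n → Bool → ℝ) (S : Finset (Fin n)) :
    fourierCoeff (fun x => ∏ i, g i (x i)) S =
      ∏ i, (∑ b, g i b * if i ∈ S then signv b else 1) / 2 := by
  rw [fourierCoeff, Finset.prod_div_distrib, Finset.prod_univ_sum, Fintype.piFinset_univ]
  simp only [prod_signv, Finset.prod_mul_distrib, Finset.prod_const, Finset.card_univ,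
    Fintype.card_fin]

theorem fourierCoeff_one {n : ℕ} (S : Finset (Fin n)) :
    fourierCoeff (fun _ => 1) S = if S = ∅ then 1 else 0 := by
  have h := fourierCoeff_prod (fun _ _ => 1) S
  simp only [Finset.prod_const_one] at h
  rw [h]
  split_ifs with hS
  · simp [hS]
  · obtain ⟨i, hi⟩ := Finset.nonempty_iff_ne_empty.2 hS
    exact Finset.prod_eq_zero (Finset.mem_univ i) (by simp [hi, signv])

theorem fourierCoeff_sub_sum {n : ℕ} {ι : Type*} [Fintype ι] (f : (Fin n → Bool) → ℝ)
    (g : ι → (Fin n → Bool) → ℝ) (S : Finset (Fin n)) :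
    fourierCoeff (fun x => f x - 2 * ∑ a, g a x) S =
      fourierCoeff f S - 2 * ∑ a, fourierCoeff (g a) S := by
  simp only [fourierCoeff, ← Finset.sum_div, sub_mul, Finset.sum_sub_distrib, mul_assoc,
    ← Finset.mul_sum, Finset.sum_mul]
  rw [Finset.sum_comm]
  ring

theorem weight_eq {n : ℕ} {f : (Fin n → Bool) → ℝ} (hf : IsBooleanFunc f) :
    weight f = (1 - fourierCoeff f ∅) / 2 := by
  have h : ∀ x, f x = 1 - 2 * if f x = -1 then 1 else 0 := by
    intro x
    rcases hf x with h | h <;> rw [h] <;> norm_num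
  have hs : ∑ x, f x =
      2 ^ n - 2 * ((Finset.univ.filter (fun x : Fin n → Bool => f x = -1)).card : ℝ) := by
    rw [Finset.sum_congr rfl fun x _ => h x, Finset.sum_sub_distrib, ← Finset.mul_sum,
      Finset.sum_boole]
    simp
  simp only [weight, fourierCoeff, Finset.prod_empty, mul_one, hs]
  field_simp
  ring

variable {τ m : ℕ}

theorem isBooleanFunc_ADcomp_ANDf : IsBooleanFunc (ADcomp τ m (ANDf m)) := by
  intro x
  simp only [ADcomp, ANDf]
  split_ifs <;> simp

/-- Single-coordinate factors of the indicator that the address is `a` and block `binIdx τ a` is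
all `true`. -/
def cellFactor (m : ℕ) (a : Fin τ → Bool) (i : Fin (τ + 2 ^ τ * m)) (b : Bool) : ℝ :=
  Fin.addCases (motive := fun _ => ℝ) (fun j => if b = a j then 1 else 0)
    (fun k => if (finProdFinEquiv.symm k).1 = binIdx τ a → b = true then 1 else 0) i

@[simp] theorem cellFactor_castAdd (a : Fin τ → Bool) (j : Fin τ) (b : Bool) :
    cellFactor m a (Fin.castAdd _ j) b = if b = a j then 1 else 0 := by
  simp [cellFactor]

@[simp] theorem cellFactor_blockIdx (a : Fin τ → Bool) (p : Fin (2 ^ τ)) (l : Fin m) (b : Bool) :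
    cellFactor m a (blockIdx τ m p l) b = if p = binIdx τ a → b = true then 1 else 0 := by
  simp only [cellFactor, blockIdx, Fin.addCases_right, Equiv.symm_apply_apply]

theorem ADcomp_ANDf_eq (x : Fin (τ + 2 ^ τ * m) → Bool) :
    ADcomp τ m (ANDf m) x = 1 - 2 * ∑ a : Fin τ → Bool, ∏ i, cellFactor m a i (x i) := by
  set v : Fin τ → Bool := fun j => x (Fin.castAdd _ j) with hv
  have hsum : ∑ a : Fin τ → Bool, ∏ i, cellFactor m a i (x i) =
      if ∀ l, x (blockIdx τ m (binIdx τ v) l) = true then 1 else 0 := by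
    rw [Finset.sum_eq_single v]
    · rw [prod_index]
      rw [Finset.prod_eq_one fun j _ => by simp [hv], one_mul,
        Finset.prod_eq_single (binIdx τ v)]
      · simp [Finset.prod_boole]
      · intro p _ hp
        exact Finset.prod_eq_one fun l _ => by simp [hp]
      · simp
    · intro a _ ha
      obtain ⟨j, hj⟩ := Function.ne_iff.1 ha
      refine Finset.prod_eq_zero (Finset.mem_univ (Fin.castAdd _ j)) ?_
      rw [cellFactor_castAdd, if_neg]
      exact fun h => hj h.symm
    · simp
  rw [hsum]
  simp only [ADcomp, ANDf, blockIdx, hv]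
  split_ifs <;> norm_num

theorem fourierCoeff_ADcomp_ANDf (S : Finset (Fin (τ + 2 ^ τ * m))) :
    fourierCoeff (ADcomp τ m (ANDf m)) S = (if S = ∅ then 1 else 0) -
      2 * ∑ a : Fin τ → Bool, (∏ j, (if Fin.castAdd _ j ∈ S then signv (a j) else 1) / 2) *
        ∏ p, ∏ l, if p = binIdx τ a then (if blockIdx τ m p l ∈ S then -1 else 1) / 2
          else if blockIdx τ m p l ∈ S then 0 else (1 : ℝ) := by
  rw [funext (ADcomp_ANDf_eq (τ := τ) (m := m)), fourierCoeff_sub_sum, fourierCoeff_one]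
  congr 2
  refine Finset.sum_congr rfl fun a _ => ?_
  rw [fourierCoeff_prod, prod_index]
  congr 1
  · refine Finset.prod_congr rfl fun j _ => ?_
    simp
  · refine Finset.prod_congr rfl fun p _ => Finset.prod_congr rfl fun l _ => ?_
    by_cases hp : p = binIdx τ a <;> by_cases hl : blockIdx τ m p l ∈ S <;>
      simp [hp, hl, signv]

/-- If `S` touches no block but `p`, then only the address of block `p` contributes. -/
theorem prod_blocks_eq {S : Finset (Fin (τ + 2 ^ τ * m))} {p : Fin (2 ^ τ)}
    (hp : ∀ q, Touches S q → q = p) :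
    (∏ q, ∏ l, if q = p then (if blockIdx τ m q l ∈ S then -1 else 1) / 2
          else if blockIdx τ m q l ∈ S then 0 else (1 : ℝ)) =
      ∏ l, (if blockIdx τ m p l ∈ S then -1 else 1) / 2 := by
  rw [Finset.prod_eq_single p]
  · simp
  · intro q _ hq
    refine Finset.prod_eq_one fun l _ => ?_
    rw [if_neg hq, if_neg]
    exact fun h => hq (hp q ⟨l, h⟩)
  · simp

theorem prod_blocks_eq_zero {S : Finset (Fin (τ + 2 ^ τ * m))} {p q : Fin (2 ^ τ)}
    (hq : Touches S q) (hqp : q ≠ p) :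
    (∏ q, ∏ l, if q = p then (if blockIdx τ m q l ∈ S then -1 else 1) / 2
          else if blockIdx τ m q l ∈ S then 0 else (1 : ℝ)) = 0 := by
  obtain ⟨l, hl⟩ := hq
  refine Finset.prod_eq_zero (Finset.mem_univ q) (Finset.prod_eq_zero (Finset.mem_univ l) ?_)
  rw [if_neg hqp, if_pos hl]

theorem fourierCoeff_empty :
    fourierCoeff (ADcomp τ m (ANDf m)) ∅ = 1 - 2 / 2 ^ m := by
  rw [fourierCoeff_ADcomp_ANDf]
  have h : ∀ q p : Fin (2 ^ τ),
      Touches (∅ : Finset (Fin (τ + 2 ^ τ * m))) q → q = p := by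
    rintro q p ⟨l, hl⟩
    simp at hl
  simp only [prod_blocks_eq (h · _)]
  simp [div_eq_mul_inv]

theorem fourierCoeff_eq_zero_of_not_touches {S : Finset (Fin (τ + 2 ^ τ * m))} (hS : S ≠ ∅)
    (h : ∀ p, ¬ Touches S p) : fourierCoeff (ADcomp τ m (ANDf m)) S = 0 := by
  obtain ⟨i, hi⟩ := Finset.nonempty_iff_ne_empty.2 hS
  obtain ⟨j, rfl⟩ | ⟨p, l, rfl⟩ := index_cases i
  swap
  · exact absurd ⟨l, hi⟩ (h p)
  rw [fourierCoeff_ADcomp_ANDf, if_neg hS]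
  simp only [prod_blocks_eq (fun q hq => absurd hq (h q))]
  have hl : ∀ p l, blockIdx τ m p l ∉ S := fun p l hpl => h p ⟨l, hpl⟩
  simp only [hl, if_false, ← Finset.sum_mul]
  have : ∑ a : Fin τ → Bool, ∏ j, (if Fin.castAdd _ j ∈ S then signv (a j) else 1) / 2 = 0 := by
    rw [← Fintype.piFinset_univ,
      ← Finset.prod_univ_sum (fun _ => Finset.univ)
        (fun j b => (if Fin.castAdd (2 ^ τ * m) j ∈ S then signv b else 1) / 2)]
    refine Finset.prod_eq_zero (Finset.mem_univ j) ?_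
    norm_num [hi, signv]
  rw [this]
  simp

theorem fourierCoeff_eq_zero_of_touches {S : Finset (Fin (τ + 2 ^ τ * m))} {p q : Fin (2 ^ τ)}
    (hp : Touches S p) (hq : Touches S q) (hpq : p ≠ q) :
    fourierCoeff (ADcomp τ m (ANDf m)) S = 0 := by
  have hS : S ≠ ∅ := by
    rintro rfl
    obtain ⟨l, hl⟩ := hp
    simp at hl
  rw [fourierCoeff_ADcomp_ANDf, if_neg hS, Finset.sum_eq_zero, mul_zero, sub_zero]
  intro a _
  by_cases ha : p = binIdx τ a
  · rw [prod_blocks_eq_zero hq (ha ▸ hpq.symm), mul_zero]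
  · rw [prod_blocks_eq_zero hp ha, mul_zero]

theorem binIdx_bijective (τ : ℕ) : Function.Bijective (binIdx τ) := by
  rw [Fintype.bijective_iff_injective_and_card]
  refine ⟨fun v w h => ?_, by simp⟩
  have h := finFunctionFinEquiv.injective h
  funext i
  have hi := congrFun h i
  cases hv : v i <;> cases hw : w i <;> simp_all

theorem abs_fourierCoeff_of_existsUnique {S : Finset (Fin (τ + 2 ^ τ * m))}
    (h : ∃! p, Touches S p) :
    |fourierCoeff (ADcomp τ m (ANDf m)) S| = 2 / (2 ^ τ * 2 ^ m) := by
  obtain ⟨p, hp, hu⟩ := h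
  have hS : S ≠ ∅ := by
    rintro rfl
    obtain ⟨l, hl⟩ := hp
    simp at hl
  obtain ⟨a, rfl⟩ := (binIdx_bijective τ).2 p
  rw [fourierCoeff_ADcomp_ANDf, if_neg hS, Finset.sum_eq_single a]
  · rw [prod_blocks_eq hu]
    have h1 : ∀ j, |(if Fin.castAdd _ j ∈ S then signv (a j) else 1) / 2| = (1 / 2 : ℝ) := by
      intro j
      rw [abs_div]
      unfold signv
      split_ifs <;> simp
    have h2 : ∀ l, |(if blockIdx τ m (binIdx τ a) l ∈ S then -1 else 1) / 2| = (1 / 2 : ℝ) := by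
      intro l
      rw [abs_div]
      split_ifs <;> simp
    rw [zero_sub, abs_neg, abs_mul, abs_mul, Finset.abs_prod, Finset.abs_prod,
      Finset.prod_congr rfl fun j _ => h1 j, Finset.prod_congr rfl fun l _ => h2 l]
    simp only [Finset.prod_const, Finset.card_univ, Fintype.card_fin, abs_two, one_div, inv_pow]
    field_simp
  · intro b _ hb
    rw [prod_blocks_eq_zero hp, mul_zero]
    exact fun hab => hb ((binIdx_bijective τ).1 hab.symm)
  · simp

theorem existsUnique_touches_of_mem_fourierSupport {S : Finset (Fin (τ + 2 ^ τ * m))}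
    (hS : S ≠ ∅) (h : fourierCoeff (ADcomp τ m (ANDf m)) S ≠ 0) : ∃! p, Touches S p := by
  by_cases hp : ∃ p, Touches S p
  · obtain ⟨p, hp⟩ := hp
    refine ⟨p, hp, fun q hq => ?_⟩
    by_contra hqp
    exact h (fourierCoeff_eq_zero_of_touches hq hp hqp)
  · exact absurd (fourierCoeff_eq_zero_of_not_touches hS (not_exists.1 hp)) h

theorem mem_fourierSupport_of_existsUnique {S : Finset (Fin (τ + 2 ^ τ * m))}
    (h : ∃! p, Touches S p) : S ∈ fourierSupport (ADcomp τ m (ANDf m)) := by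
  simp only [fourierSupport, Finset.mem_filter, Finset.mem_univ, true_and]
  rw [← abs_pos, abs_fourierCoeff_of_existsUnique h]
  positivity

theorem sparsity_le : sparsity (ADcomp τ m (ANDf m)) ≤ 2 ^ τ * (2 ^ τ * 2 ^ m) := by
  have hsub : fourierSupport (ADcomp τ m (ANDf m)) ⊆
      Finset.univ.image fun x : Finset (Fin τ) × Fin (2 ^ τ) × Finset (Fin m) =>
        blockSet x.1 x.2.1 x.2.2 := by
    intro S hS
    simp only [fourierSupport, Finset.mem_filter, Finset.mem_univ, true_and] at hS
    rw [Finset.mem_image]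
    obtain ⟨p, hp⟩ : ∃ p, ∀ q, Touches S q → q = p := by
      by_cases hS' : S = ∅
      · refine ⟨0, ?_⟩
        rintro q ⟨l, hl⟩
        simp [hS'] at hl
      · exact (existsUnique_touches_of_mem_fourierSupport hS' hS).imp fun _ h => h.2
    exact ⟨(_, p, _), Finset.mem_univ _, eq_blockSet hp⟩
  refine (Finset.card_le_card hsub).trans (Finset.card_image_le.trans ?_)
  simp

theorem le_sparsity :
    2 ^ τ * (2 ^ τ * (2 ^ m - 1)) ≤ sparsity (ADcomp τ m (ANDf m)) := by
  have hcard : ((Finset.univ : Finset (Finset (Fin τ))) ×ˢ (Finset.univ : Finset (Fin (2 ^ τ))) ×ˢ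
      (Finset.univ : Finset (Finset (Fin m))).erase ∅).card = 2 ^ τ * (2 ^ τ * (2 ^ m - 1)) := by
    simp [Finset.card_product, Finset.card_erase_of_mem]
  rw [← hcard]
  refine Finset.card_le_card_of_injOn (fun x => blockSet x.1 x.2.1 x.2.2) ?_ ?_
  · rintro ⟨A, p, B⟩ h
    simp only [Finset.coe_product, Set.mem_prod, Finset.mem_coe, Finset.mem_erase] at h
    exact mem_fourierSupport_of_existsUnique
      (existsUnique_touches_blockSet A p (Finset.nonempty_iff_ne_empty.2 h.2.2.1))
  · refine blockSet_injOn.mono ?_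
    rintro ⟨A, p, B⟩ h
    simp only [Finset.coe_product, Set.mem_prod, Finset.mem_coe, Finset.mem_erase] at h
    exact Finset.nonempty_iff_ne_empty.2 h.2.2.1

theorem span_indicatorVec_eq_top (hm : 0 < m) :
    Submodule.span (ZMod 2)
      (indicatorVec '' {S : Finset (Fin (τ + 2 ^ τ * m)) | ∃! p, Touches S p}) = ⊤ := by
  set V := Submodule.span (ZMod 2)
      (indicatorVec '' {S : Finset (Fin (τ + 2 ^ τ * m)) | ∃! p, Touches S p})
  have hV : ∀ A p (l : Fin m), indicatorVec (blockSet A p {l} : Finset (Fin (τ + 2 ^ τ * m))) ∈ V :=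
    fun A p l => Submodule.subset_span
      ⟨_, existsUnique_touches_blockSet A p (Finset.singleton_nonempty l), rfl⟩
  have hsingle : ∀ i, (Pi.single i 1 : Fin (τ + 2 ^ τ * m) → ZMod 2) ∈ V := by
    intro i
    obtain ⟨j, rfl⟩ | ⟨p, l, rfl⟩ := index_cases i
    · convert V.sub_mem (hV {j} 0 ⟨0, hm⟩) (hV ∅ 0 ⟨0, hm⟩) using 1
      ext i
      obtain ⟨j', rfl⟩ | ⟨p, l, rfl⟩ := index_cases i
      · simp [indicatorVec, Pi.single_apply]
      · have : blockIdx τ m p l ≠ Fin.castAdd _ j := by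
          simp only [blockIdx, ne_eq, Fin.ext_iff, Fin.val_natAdd, Fin.val_castAdd]
          omega
        simp [indicatorVec, this]
    · convert hV ∅ p l using 1
      ext i
      obtain ⟨j', rfl⟩ | ⟨q, l', rfl⟩ := index_cases i
      · have : Fin.castAdd _ j' ≠ blockIdx τ m p l := by
          simp only [blockIdx, ne_eq, Fin.ext_iff, Fin.val_natAdd, Fin.val_castAdd]
          omega
        simp [indicatorVec, this]
      · have : blockIdx τ m q l' = blockIdx τ m p l ↔ q = p ∧ l' = l := by
          simp [blockIdx]
        simp [indicatorVec, Pi.single_apply, this]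
  rw [eq_top_iff, ← (Pi.basisFun (ZMod 2) _).span_eq, Submodule.span_le]
  rintro _ ⟨i, rfl⟩
  simpa using hsingle i

theorem finrank_span_indicatorVec (hm : 0 < m) {T : Set (Finset (Fin (τ + 2 ^ τ * m)))}
    (hT : {S | ∃! p, Touches S p} ⊆ T) :
    Module.finrank (ZMod 2) ↥(Submodule.span (ZMod 2) (indicatorVec '' T)) = τ + 2 ^ τ * m := by
  have h : Submodule.span (ZMod 2) (indicatorVec '' T) = ⊤ :=
    eq_top_iff.2 ((span_indicatorVec_eq_top hm).ge.trans (Submodule.span_mono (Set.image_mono hT)))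
  rw [h, finrank_top, Module.finrank_fin_fun]

theorem fourierRank_ADcomp_ANDf (hm : 0 < m) :
    fourierRank (ADcomp τ m (ANDf m)) = τ + 2 ^ τ * m :=
  finrank_span_indicatorVec hm fun _ h => mem_fourierSupport_of_existsUnique h

theorem levelDim_of_le (hm : 0 < m) {x : ℝ} (hx : 2 ^ τ * 2 ^ m / 2 ≤ x) :
    levelDim (ADcomp τ m (ANDf m)) x = τ + 2 ^ τ * m := by
  refine finrank_span_indicatorVec hm fun S hS => ?_
  rw [Set.mem_ofPred_eq, abs_fourierCoeff_of_existsUnique hS, ← one_div_div (2 ^ τ * 2 ^ m : ℝ) 2]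
  exact one_div_le_one_div_of_le (by positivity) hx

theorem levelDim_of_lt {x : ℝ} (hx : 0 < x) (hx' : x < 2 ^ τ * 2 ^ m / 2) :
    levelDim (ADcomp τ m (ANDf m)) x = 0 := by
  have h : Submodule.span (ZMod 2) (indicatorVec ''
      {S | 1 / x ≤ |fourierCoeff (ADcomp τ m (ANDf m)) S|}) = ⊥ := by
    rw [Submodule.span_eq_bot]
    rintro _ ⟨S, hS, rfl⟩
    have hS' : S = ∅ := by
      by_contra hne
      have hpos : 0 < 1 / x := by positivity
      have hu := existsUnique_touches_of_mem_fourierSupport hne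
        (abs_pos.1 (hpos.trans_le hS))
      rw [Set.mem_ofPred_eq, abs_fourierCoeff_of_existsUnique hu, ← one_div_div (2 ^ τ * 2 ^ m : ℝ) 2] at hS
      exact absurd hS (not_le.2 (one_div_lt_one_div_of_lt hx hx'))
    ext i
    simp [hS', indicatorVec]
  rw [levelDim, h, finrank_bot]

theorem maxRankEntropy_ADcomp_ANDf (hm : 0 < m) :
    maxRankEntropy (ADcomp τ m (ANDf m)) = 2 ^ τ * 2 ^ m / 2 := by
  have h : {x : ℝ | 0 < x ∧ levelDim (ADcomp τ m (ANDf m)) x =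
      fourierRank (ADcomp τ m (ANDf m))} = Set.Ici (2 ^ τ * 2 ^ m / 2) := by
    ext x
    rw [fourierRank_ADcomp_ANDf hm, Set.mem_ofPred_eq, Set.mem_Ici]
    constructor
    · rintro ⟨hx, hd⟩
      by_contra hlt
      rw [levelDim_of_lt hx (not_le.1 hlt)] at hd
      have : 0 < 2 ^ τ * m := by positivity
      omega
    · intro hx
      exact ⟨lt_of_lt_of_le (by positivity) hx, levelDim_of_le hm hx⟩
  rw [maxRankEntropy, h, csInf_Ici]

theorem maxSuppEntropy_ADcomp_ANDf (hm : 2 ≤ m) :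
    maxSuppEntropy (ADcomp τ m (ANDf m)) = 2 ^ τ * 2 ^ m / 2 := by
  have hτ : (1 : ℝ) ≤ 2 ^ τ := one_le_pow₀ one_le_two
  have hm4 : (4 : ℝ) ≤ 2 ^ m := by
    calc (4 : ℝ) = 2 ^ 2 := by norm_num
      _ ≤ 2 ^ m := pow_le_pow_right₀ one_le_two hm
  refine IsGreatest.csSup_eq ⟨?_, ?_⟩
  · have hu := existsUnique_touches_blockSet (∅ : Finset (Fin τ)) 0
      (Finset.singleton_nonempty (⟨0, by omega⟩ : Fin m))
    refine ⟨_, mem_fourierSupport_of_existsUnique hu, ?_⟩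
    dsimp only
    rw [abs_fourierCoeff_of_existsUnique hu, one_div_div]
  · rintro _ ⟨S, hS, rfl⟩
    simp only [fourierSupport, Finset.coe_filter, Finset.mem_univ, true_and,
      Set.mem_ofPred_eq] at hS
    dsimp only
    by_cases hS' : S = ∅
    · subst hS'
      have hhalf : (1 / 2 : ℝ) ≤ 1 - 2 / 2 ^ m := by
        have : (2 : ℝ) / 2 ^ m ≤ 1 / 2 := by
          rw [div_le_div_iff₀ (by positivity) two_pos]
          linarith
        linarith
      rw [fourierCoeff_empty, abs_of_pos (by linarith)]
      calc 1 / (1 - 2 / 2 ^ m : ℝ) ≤ 1 / (1 / 2) :=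
            one_div_le_one_div_of_le (by norm_num) hhalf
        _ ≤ 2 ^ τ * 2 ^ m / 2 := by nlinarith
    · rw [abs_fourierCoeff_of_existsUnique (existsUnique_touches_of_mem_fourierSupport hS' hS),
        one_div_div]

end Fourier

/-- **Claim (beating Chang's lemma for all thresholds, for `AD_{t,t}`).** There are
universal constants `C, c > 0` such that for every power of two `t = 2^τ > 4` the
function `f = AD_t ∘ₜ AND_{log t}` satisfies: (i) `δ(f) = 1/t`; (ii) every non-empty
`S ∈ supp(f)` has `|f̂(S)| = 2/t²`; (iii) for every threshold `x > 0` with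
`d_x := dim(span{S : |f̂(S)| ≥ 1/x}) > 1`,
`√d_x/(x·√(log₂(x²/d_x))) ≤ C·t^{-3/2}`; and (iv) `r(f)²/(k(f)·log₂² k(f)) ≥ c/t`,
`k(f)/k'(f)² ≥ c/t` and `r(f)/(k''(f)·log₂ k(f)) ≥ c/t`. -/
theorem ADtt_beats_Chang :
    ∃ C c : ℝ, 0 < C ∧ 0 < c ∧
      ∀ τ : ℕ, 3 ≤ τ →
        weight (ADcomp τ τ (ANDf τ)) = 1 / 2 ^ τ ∧
        (∀ S ∈ fourierSupport (ADcomp τ τ (ANDf τ)), S ≠ ∅ →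
          |fourierCoeff (ADcomp τ τ (ANDf τ)) S| = 2 / ((2 : ℝ) ^ τ) ^ 2) ∧
        (∀ x : ℝ, 0 < x → 1 < levelDim (ADcomp τ τ (ANDf τ)) x →
          Real.sqrt (levelDim (ADcomp τ τ (ANDf τ)) x) /
              (x * Real.sqrt (Real.logb 2
                (x ^ 2 / (levelDim (ADcomp τ τ (ANDf τ)) x : ℝ)))) ≤
            C * ((2 : ℝ) ^ τ) ^ (-(3 : ℝ) / 2)) ∧
        (c / 2 ^ τ ≤ (fourierRank (ADcomp τ τ (ANDf τ)) : ℝ) ^ 2 /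
            ((sparsity (ADcomp τ τ (ANDf τ)) : ℝ) *
              (Real.logb 2 (sparsity (ADcomp τ τ (ANDf τ)))) ^ 2) ∧
        c / 2 ^ τ ≤ (sparsity (ADcomp τ τ (ANDf τ)) : ℝ) /
            (maxSuppEntropy (ADcomp τ τ (ANDf τ))) ^ 2 ∧
        c / 2 ^ τ ≤ (fourierRank (ADcomp τ τ (ANDf τ)) : ℝ) /
            (maxRankEntropy (ADcomp τ τ (ANDf τ)) *
              Real.logb 2 (sparsity (ADcomp τ τ (ANDf τ))))) := by
  refine ⟨4, 1 / 9, by norm_num, by norm_num, fun τ hτ => ?_⟩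
  have hpos : 0 < τ := by omega
  set f := ADcomp τ τ (ANDf τ)
  have hτR : (3 : ℝ) ≤ τ := by exact_mod_cast hτ
  have hτ_pos : (0 : ℝ) < τ := by linarith
  have ht8 : (8 : ℝ) ≤ 2 ^ τ := by
    calc (8 : ℝ) = 2 ^ 3 := by norm_num
      _ ≤ 2 ^ τ := pow_le_pow_right₀ one_le_two hτ
  have htτ : (τ : ℝ) ≤ 2 ^ τ := by exact_mod_cast Nat.lt_two_pow_self.le
  have hrank : (fourierRank f : ℝ) = τ + 2 ^ τ * τ := by
    rw [fourierRank_ADcomp_ANDf hpos]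
    push_cast
    rfl
  have hsupp : maxSuppEntropy f = 2 ^ τ * 2 ^ τ / 2 := maxSuppEntropy_ADcomp_ANDf (by omega)
  have hre : maxRankEntropy f = 2 ^ τ * 2 ^ τ / 2 := maxRankEntropy_ADcomp_ANDf hpos
  have hk_le : (sparsity f : ℝ) ≤ 2 ^ τ * (2 ^ τ * 2 ^ τ) := by
    exact_mod_cast sparsity_le (τ := τ) (m := τ)
  have hk_ge : (2 : ℝ) ^ τ * (2 ^ τ * (2 ^ τ - 1)) ≤ sparsity f := by
    have h := le_sparsity (τ := τ) (m := τ)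
    rw [← Nat.cast_le (α := ℝ)] at h
    push_cast [Nat.one_le_two_pow] at h
    exact h
  have hweight : weight f = 1 / 2 ^ τ := by
    rw [weight_eq isBooleanFunc_ADcomp_ANDf, fourierCoeff_empty]
    ring
  have hlevel := fun x => levelDim_of_le (τ := τ) hpos (x := x)
  have hlevel_lt := fun x => levelDim_of_lt (τ := τ) (m := τ) (x := x)
  have hlogt : Real.logb 2 (2 ^ τ) = τ := by
    rw [Real.logb_pow, Real.logb_self_eq_one one_lt_two, mul_one]
  set t : ℝ := 2 ^ τ
  have ht : 0 < t := by linarith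
  have hk_half : t ^ 3 / 2 ≤ sparsity f := by nlinarith [sq_nonneg t]
  have hk_one : (1 : ℝ) < sparsity f := by nlinarith [sq_nonneg t]
  have hlog_pos : 0 < Real.logb 2 (sparsity f) := Real.logb_pos one_lt_two hk_one
  have hlog_le : Real.logb 2 (sparsity f) ≤ 3 * τ := by
    calc Real.logb 2 (sparsity f) ≤ Real.logb 2 (t * (t * t)) :=
          Real.logb_le_logb_of_le one_lt_two (by linarith) hk_le
      _ = 3 * τ := by
          rw [Real.logb_mul ht.ne' (by positivity), Real.logb_mul ht.ne' ht.ne', hlogt]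
          ring
  have hrank_ge : t * τ ≤ fourierRank f := by rw [hrank]; linarith
  refine ⟨hweight, fun S hS hne => ?_, fun x hx hd => ?_, ?_, ?_, ?_⟩
  · rw [sq]
    exact abs_fourierCoeff_of_existsUnique (existsUnique_touches_of_mem_fourierSupport hne
      (by simpa [fourierSupport] using hS))
  · have hxt : t * t / 2 ≤ x := by
      by_contra hlt
      rw [hlevel_lt x hx (not_le.1 hlt)] at hd
      omega
    have hd : (levelDim f x : ℝ) = τ + t * τ := by
      rw [hlevel x hxt]
      push_cast
      rfl
    rw [hd]
    have hL : (τ : ℝ) ≤ Real.logb 2 (x ^ 2 / (τ + t * τ)) := by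
      refine hlogt.ge.trans (Real.logb_le_logb_of_le one_lt_two ht ?_)
      rw [le_div_iff₀ (by positivity)]
      have h1 : (t * t / 2) ^ 2 ≤ x ^ 2 := pow_le_pow_left₀ (by positivity) hxt 2
      have h2 : 8 * (τ : ℝ) ≤ t * t := mul_le_mul ht8 htτ (by positivity) ht.le
      have h3 : t * t * (8 * τ) ≤ t * t * (t * t) := mul_le_mul_of_nonneg_left h2 (by positivity)
      have h4 : t * (τ * 1) ≤ t * (τ * t) := by gcongr; linarith
      nlinarith
    have hs0 : 0 < Real.sqrt t := Real.sqrt_pos.2 ht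
    have hτ0 : 0 < Real.sqrt (τ : ℝ) := Real.sqrt_pos.2 hτ_pos
    have hpow : t ^ (-(3 : ℝ) / 2) = (t * Real.sqrt t)⁻¹ := by
      rw [neg_div, Real.rpow_neg ht.le, show (3 : ℝ) / 2 = 1 + 1 / 2 by norm_num,
        Real.rpow_add ht, Real.rpow_one, Real.sqrt_eq_rpow]
    have hnum : Real.sqrt (τ + t * τ) ≤ 2 * (Real.sqrt τ * Real.sqrt t) := by
      rw [← Real.sqrt_mul (by positivity)]
      refine Real.sqrt_le_iff.2 ⟨by positivity, ?_⟩
      rw [mul_pow, Real.sq_sqrt (by positivity)]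
      nlinarith
    have hden : t * t / 2 * Real.sqrt τ ≤
        x * Real.sqrt (Real.logb 2 (x ^ 2 / (τ + t * τ))) := by
      gcongr
    calc _ ≤ 2 * (Real.sqrt τ * Real.sqrt t) / (t * t / 2 * Real.sqrt τ) := by gcongr
      _ = 4 * t ^ (-(3 : ℝ) / 2) := by
        rw [hpow]
        field_simp
        rw [Real.sq_sqrt ht.le]
        ring
  · calc 1 / 9 / t = (t * τ) ^ 2 / (t * (t * t) * (3 * τ) ^ 2) := by
          field_simp
          norm_num
      _ ≤ _ := by gcongr
  · rw [hsupp]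
    calc 1 / 9 / t ≤ 2 / t := by gcongr; norm_num
      _ = t ^ 3 / 2 / (t * t / 2) ^ 2 := by
          field_simp
      _ ≤ _ := by gcongr
  · rw [hre]
    calc 1 / 9 / t ≤ 2 / 3 / t := by gcongr <;> norm_num
      _ = t * τ / (t * t / 2 * (3 * τ)) := by field_simp
      _ ≤ _ := by gcongr

end BoolFunc

end
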